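/- Let E : ℝ×ℝ³ → ℝ³ be C¹ with bounded derivatives, and let (Y⁰,U⁰) solve dY⁰/dt = U⁰_∥ + (1/2π)∫₀^{2π} 𝓡(−θ)E(t, Y⁰+𝓡(θ)U⁰) dθ, dU⁰/dt = (1/2π)∫₀^{2π} R(−θ)E(t, Y⁰+𝓡(θ)U⁰) dθ, with Y⁰(s) = x, U⁰(s) = v. Then for every T > 0, lim_{ε→0} sup_{t∈[s,s+T]} |X_ε(t) − (Y⁰(t) + 𝓡((t−s)/ε)U⁰(t))| = 0 and lim_{ε→0} sup_{t∈[s,s+T]} |V_ε(t) − R((t−s)/ε)U⁰(t)| = 0. -/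

import Mathlib

open Real Set Filter Matrix MeasureTheory intervalIntegral

/-- The rotation matrix of angle `-θ` around the first axis. -/
noncomputable def Rrot (θ : ℝ) : Matrix (Fin 3) (Fin 3) ℝ :=
  !![1, 0, 0; 0, Real.cos θ, Real.sin θ; 0, -Real.sin θ, Real.cos θ]

/-- The matrix `𝓡(θ)`. -/
noncomputable def scrR (θ : ℝ) : Matrix (Fin 3) (Fin 3) ℝ :=
  !![0, 0, 0; 0, Real.sin θ, 1 - Real.cos θ; 0, Real.cos θ - 1, Real.sin θ]

/-- The orthogonal projection onto the first axis. -/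
noncomputable def Pmat : Matrix (Fin 3) (Fin 3) ℝ := !![1, 0, 0; 0, 0, 0; 0, 0, 0]

/-- The first vector of the canonical basis of `ℝ³`. -/
noncomputable def ee1 : Fin 3 → ℝ := ![1, 0, 0]

/-- The third vector of the canonical basis of `ℝ³`. -/
noncomputable def ee3 : Fin 3 → ℝ := ![0, 0, 1]

/-- The component of `v` parallel to the first axis: `v_∥ = (v·e₁)e₁`. -/
noncomputable def vpar (v : Fin 3 → ℝ) : Fin 3 → ℝ := ![v 0, 0, 0]

/-- The cross product on `ℝ³`. -/
def cross3 (u v : Fin 3 → ℝ) : Fin 3 → ℝ :=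
  ![u 1 * v 2 - u 2 * v 1, u 2 * v 0 - u 0 * v 2, u 0 * v 1 - u 1 * v 0]

/-- The Euclidean norm on `ℝ³`. -/
noncomputable def euclN (v : Fin 3 → ℝ) : ℝ := Real.sqrt (v 0 ^ 2 + v 1 ^ 2 + v 2 ^ 2)

section Averaging

variable {W : Type*} [NormedAddCommGroup W] [NormedSpace ℝ W]

lemma integral_period_comp_eq_zero {f : ℝ → W} {p : ℝ} (hper : Function.Periodic f p)
    (hmean : ∫ θ in (0 : ℝ)..p, f θ = 0) {ε : ℝ} (hε : 0 < ε) (a b : ℝ) :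
    ∫ r in b..(b + p * ε), f ((r - a) / ε) = 0 := by
  rw [intervalIntegral.integral_comp_sub_right (fun r => f (r / ε)) a,
    intervalIntegral.integral_comp_div f hε.ne']
  have hb : (b + p * ε - a) / ε = (b - a) / ε + p := by field_simp; ring
  rw [hb, hper.intervalIntegral_add_eq _ 0, zero_add, hmean, smul_zero]

lemma norm_integral_oscillating_period_le {g : ℝ → ℝ → W} {p a b η ε : ℝ}
    (hg : Continuous (Function.uncurry g))
    (hper : ∀ r, Function.Periodic (g r) p) (hp : 0 < p)
    (hmean : ∀ r, ∫ θ in (0 : ℝ)..p, g r θ = 0) (hε : 0 < ε)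
    (hη : ∀ r ∈ Icc b (b + p * ε), ∀ θ, ‖g r θ - g b θ‖ ≤ η) :
    ‖∫ r in b..(b + p * ε), g r ((r - a) / ε)‖ ≤ p * ε * η := by
  have hc : Continuous fun r => g r ((r - a) / ε) :=
    hg.comp (f := fun r => (r, (r - a) / ε)) (by fun_prop)
  have hcb : Continuous fun r => g b ((r - a) / ε) :=
    hg.comp (f := fun r => (b, (r - a) / ε)) (by fun_prop)
  have hpε : 0 < p * ε := mul_pos hp hε
  have hsub : ∫ r in b..(b + p * ε), g r ((r - a) / ε) =
      ∫ r in b..(b + p * ε), (g r ((r - a) / ε) - g b ((r - a) / ε)) := by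
    rw [intervalIntegral.integral_sub (hc.intervalIntegrable _ _) (hcb.intervalIntegrable _ _),
      integral_period_comp_eq_zero (hper b) (hmean b) hε, sub_zero]
  rw [hsub]
  refine (intervalIntegral.norm_integral_le_of_norm_le_const (C := η) fun r hr => ?_).trans ?_
  · rw [uIoc_of_le (by linarith)] at hr
    exact hη r (Ioc_subset_Icc_self hr) _
  · rw [add_sub_cancel_left, abs_of_pos hpε, mul_comm]

lemma norm_integral_oscillating_le {g : ℝ → ℝ → W} {p a T M η ε : ℝ}
    (hg : Continuous (Function.uncurry g))
    (hper : ∀ r, Function.Periodic (g r) p) (hp : 0 < p)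
    (hmean : ∀ r, ∫ θ in (0 : ℝ)..p, g r θ = 0) (hε : 0 < ε)
    (hM : ∀ r ∈ Icc a (a + T), ∀ θ, ‖g r θ‖ ≤ M)
    (hη : ∀ r ∈ Icc a (a + T), ∀ r' ∈ Icc a (a + T), |r - r'| ≤ p * ε →
      ∀ θ, ‖g r θ - g r' θ‖ ≤ η)
    {t : ℝ} (ht : t ∈ Icc a (a + T)) :
    ‖∫ r in a..t, g r ((r - a) / ε)‖ ≤ (t - a) * η + M * (p * ε) := by
  have hc : Continuous fun r => g r ((r - a) / ε) :=
    hg.comp (f := fun r => (r, (r - a) / ε)) (by fun_prop)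
  have hpε : 0 < p * ε := mul_pos hp hε
  have hM0 : 0 ≤ M := (norm_nonneg _).trans (hM t ht 0)
  have hη0 : 0 ≤ η := (norm_nonneg _).trans (hη t ht t ht (by simpa using hpε.le) 0)
  have hperiods : ∀ n : ℕ, a + n * (p * ε) ≤ a + T →
      ‖∫ r in a..(a + n * (p * ε)), g r ((r - a) / ε)‖ ≤ n * (p * ε) * η := by
    intro n
    induction n with
    | zero => intro _; simp
    | succ n ih =>
      intro hn
      push_cast at hn ⊢
      have hn' : a + (n + 1) * (p * ε) = a + n * (p * ε) + p * ε := by ring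
      have h0 : 0 ≤ n * (p * ε) := by positivity
      rw [hn'] at hn ⊢
      rw [← intervalIntegral.integral_add_adjacent_intervals
        (hc.intervalIntegrable a (a + n * (p * ε))) (hc.intervalIntegrable _ _)]
      refine (norm_add_le _ _).trans ?_
      have h1 := ih (by linarith)
      have h2 := norm_integral_oscillating_period_le (a := a) (b := a + n * (p * ε)) (η := η)
        hg hper hp hmean hε (fun r hr θ => hη r ⟨by linarith [hr.1], by linarith [hr.2]⟩ _
          ⟨by linarith, by linarith⟩
          (by rw [abs_of_nonneg (by linarith [hr.1])]; linarith [hr.2]) θ)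
      linarith
  set n := ⌊(t - a) / (p * ε)⌋₊ with hn
  have hta : 0 ≤ t - a := by linarith [ht.1]
  have hn1 : n * (p * ε) ≤ t - a :=
    (le_div_iff₀ hpε).1 (Nat.floor_le (div_nonneg hta hpε.le))
  have hn2 : t - a ≤ (n + 1) * (p * ε) :=
    ((div_lt_iff₀ hpε).1 (Nat.lt_floor_add_one _)).le
  have h0 : 0 ≤ n * (p * ε) := by positivity
  rw [← intervalIntegral.integral_add_adjacent_intervals
    (hc.intervalIntegrable a (a + n * (p * ε))) (hc.intervalIntegrable _ _)]
  refine (norm_add_le _ _).trans (add_le_add ((hperiods n (by linarith [ht.2])).trans ?_) ?_)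
  · gcongr
  · refine (intervalIntegral.norm_integral_le_of_norm_le_const (C := M) fun r hr => ?_).trans ?_
    · rw [uIoc_of_le (by linarith)] at hr
      exact hM r ⟨by linarith [hr.1], by linarith [hr.2, ht.2]⟩ _
    · rw [abs_of_nonneg (by linarith)]
      gcongr
      linarith

/-- The primitive of a mean-zero, rapidly oscillating function is uniformly small. -/
lemma exists_norm_integral_oscillating_le {g : ℝ → ℝ → W} {p : ℝ}
    (hg : Continuous (Function.uncurry g))
    (hper : ∀ r, Function.Periodic (g r) p) (hp : 0 < p)
    (hmean : ∀ r, ∫ θ in (0 : ℝ)..p, g r θ = 0) (a : ℝ) {T : ℝ} (hT : 0 < T)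
    {η : ℝ} (hη : 0 < η) :
    ∃ ε₀ > 0, ∀ ε, 0 < ε → ε < ε₀ → ∀ t ∈ Icc a (a + T),
      ‖∫ r in a..t, g r ((r - a) / ε)‖ ≤ η := by
  have hK : IsCompact (Icc a (a + T) ×ˢ Icc 0 p) := isCompact_Icc.prod isCompact_Icc
  obtain ⟨M, hM⟩ := hK.exists_bound_of_continuousOn hg.continuousOn
  have huc := Metric.uniformContinuousOn_iff.1
    (hK.uniformContinuousOn_of_continuous hg.continuousOn) (η / (2 * T)) (by positivity)
  obtain ⟨δ, hδ, hδ'⟩ := huc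
  have hrep : ∀ θ : ℝ, ∃ θ' ∈ Icc 0 p, ∀ r, g r θ = g r θ' := fun θ =>
    ⟨toIcoMod hp 0 θ, by simpa using Ico_subset_Icc_self (toIcoMod_mem_Ico hp 0 θ), fun r => by
      rw [toIcoMod, (hper r).sub_zsmul_eq]⟩
  have hM' : ∀ r ∈ Icc a (a + T), ∀ θ, ‖g r θ‖ ≤ |M| + 1 := fun r hr θ => by
    obtain ⟨θ', hθ', h⟩ := hrep θ
    rw [h]
    exact (hM (r, θ') ⟨hr, hθ'⟩).trans (by linarith [le_abs_self M])
  have hMpos : 0 < |M| + 1 := by positivity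
  refine ⟨min (δ / p) (η / (2 * ((|M| + 1) * p))), by positivity, fun ε hε hlt t ht => ?_⟩
  have hεδ : p * ε < δ := by
    rw [mul_comm, ← lt_div_iff₀ hp]; exact hlt.trans_le (min_le_left _ _)
  have hεM : ε * (2 * ((|M| + 1) * p)) < η := by
    rw [← lt_div_iff₀ (by positivity)]; exact hlt.trans_le (min_le_right _ _)
  refine (norm_integral_oscillating_le (η := η / (2 * T)) hg hper hp hmean hε hM' ?_ ht).trans ?_
  · intro r hr r' hr' hrr θ
    obtain ⟨θ', hθ', h⟩ := hrep θ
    rw [h, h, ← dist_eq_norm]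
    refine (hδ' (r, θ') ⟨hr, hθ'⟩ (r', θ') ⟨hr', hθ'⟩ ?_).le
    rw [Prod.dist_eq, dist_self, Real.dist_eq, max_eq_left (abs_nonneg _)]
    linarith
  · have h1 : (t - a) * (η / (2 * T)) ≤ T * (η / (2 * T)) := by
      gcongr
      linarith [ht.2]
    have h2 : T * (η / (2 * T)) = η / 2 := by field_simp
    nlinarith

/-- First-order averaging principle for a vector field periodic in the fast phase. -/
theorem exists_norm_sub_averaged_solution_le [CompleteSpace W] {F : ℝ → ℝ → W → W} {p K s : ℝ}
    (hF : Continuous fun q : ℝ × ℝ × W => F q.1 q.2.1 q.2.2)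
    (hper : ∀ t z, Function.Periodic (fun θ => F t θ z) p) (hp : 0 < p) (hK : 0 < K)
    (hLip : ∀ t θ z z', ‖F t θ z - F t θ z'‖ ≤ K * ‖z - z'‖)
    {Z : ℝ → ℝ → W} {Z₀ : ℝ → W} (hinit : ∀ ε, 0 < ε → Z ε s = Z₀ s)
    (hZ : ∀ ε, 0 < ε → ∀ t, HasDerivAt (Z ε) (F t ((t - s) / ε) (Z ε t)) t)
    (hZ₀ : ∀ t, HasDerivAt Z₀ (p⁻¹ • ∫ θ in (0 : ℝ)..p, F t θ (Z₀ t)) t)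
    {T : ℝ} (hT : 0 < T) {η : ℝ} (hη : 0 < η) :
    ∃ ε₀ > 0, ∀ ε, 0 < ε → ε < ε₀ → ∀ t ∈ Icc s (s + T), ‖Z ε t - Z₀ t‖ ≤ η := by
  have hZ₀c : Continuous Z₀ := continuous_iff_continuousAt.2 fun t => (hZ₀ t).continuousAt
  have hFc : Continuous (Function.uncurry fun t θ => F t θ (Z₀ t)) :=
    hF.comp (f := fun q : ℝ × ℝ => (q.1, q.2, Z₀ q.1)) (by fun_prop)
  set A : ℝ → W := fun t => p⁻¹ • ∫ θ in (0 : ℝ)..p, F t θ (Z₀ t) with hA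
  have hAc : Continuous A :=
    (intervalIntegral.continuous_parametric_intervalIntegral_of_continuous' hFc 0 p).const_smul _
  set g : ℝ → ℝ → W := fun t θ => F t θ (Z₀ t) - A t with hgdef
  have hg : Continuous (Function.uncurry g) := hFc.sub (hAc.comp continuous_fst)
  have hgper : ∀ r, Function.Periodic (g r) p := fun r θ => by
    simp only [hgdef]
    rw [show F r (θ + p) (Z₀ r) = F r θ (Z₀ r) from hper r (Z₀ r) θ]
  have hgmean : ∀ r, ∫ θ in (0 : ℝ)..p, g r θ = 0 := fun r => by
    have hFr : Continuous fun θ => F r θ (Z₀ r) :=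
      hFc.comp (f := fun θ => (r, θ)) (by fun_prop)
    simp only [hgdef]
    rw [intervalIntegral.integral_sub (hFr.intervalIntegrable _ _)
      (continuous_const.intervalIntegrable _ _), intervalIntegral.integral_const, sub_zero, hA,
      smul_inv_smul₀ hp.ne', sub_self]
  set c := Real.exp (K * T)
  have hc : 0 < c := Real.exp_pos _
  obtain ⟨ε₀, hε₀, hosc⟩ :=
    exists_norm_integral_oscillating_le hg hgper hp hgmean s hT (div_pos hη hc)
  refine ⟨ε₀, hε₀, fun ε hε hlt t ht => ?_⟩
  set e : ℝ → W := fun t => ∫ r in s..t, g r ((r - s) / ε)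
  have hgε : Continuous fun r => g r ((r - s) / ε) :=
    hg.comp (f := fun r => (r, (r - s) / ε)) (by fun_prop)
  have he : ∀ t ∈ Icc s (s + T), ‖e t‖ ≤ η / c := hosc ε hε hlt
  have hder : ∀ r, HasDerivAt (fun r => Z ε r - Z₀ r - e r)
      (F r ((r - s) / ε) (Z ε r) - F r ((r - s) / ε) (Z₀ r)) r := fun r => by
    have h := ((hZ ε hε r).sub (hZ₀ r)).sub (intervalIntegral.integral_hasDerivAt_right
      (hgε.intervalIntegrable s r) (hgε.stronglyMeasurableAtFilter _ _) hgε.continuousAt)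
    refine h.congr_deriv ?_
    simp only [hgdef, hA]
    abel
  have hgron := norm_le_gronwallBound_of_norm_deriv_right_le (δ := 0) (K := K)
    (ε := K * (η / c)) (a := s) (b := s + T)
    (fun r _ => (hder r).continuousAt.continuousWithinAt)
    (fun r _ => (hder r).hasDerivWithinAt) (by simp [e, hinit ε hε]) (fun r hr => ?_) t ht
  · rw [gronwallBound_of_K_ne_0 hK.ne'] at hgron
    beta_reduce at hgron
    rw [zero_mul, zero_add, mul_div_cancel_left₀ _ hK.ne'] at hgron
    have hexp : Real.exp (K * (t - s)) ≤ c :=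
      Real.exp_le_exp.2 (mul_le_mul_of_nonneg_left (by linarith [ht.2]) hK.le)
    calc ‖Z ε t - Z₀ t‖ = ‖(Z ε t - Z₀ t - e t) + e t‖ := by rw [sub_add_cancel]
      _ ≤ η / c * (Real.exp (K * (t - s)) - 1) + η / c :=
        (norm_add_le _ _).trans (add_le_add hgron (he t ht))
      _ = η / c * Real.exp (K * (t - s)) := by ring
      _ ≤ η / c * c := by gcongr
      _ = η := by field_simp
  · refine (hLip _ _ _ _).trans ?_
    rw [← mul_add]
    gcongr
    calc ‖Z ε r - Z₀ r‖ = ‖(Z ε r - Z₀ r - e r) + e r‖ := by rw [sub_add_cancel]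
      _ ≤ _ := (norm_add_le _ _).trans (by gcongr; exact he r (Ico_subset_Icc_self hr))

end Averaging

lemma norm_mulVec_le_of_abs_le {A : Matrix (Fin 3) (Fin 3) ℝ} (hA : ∀ i j, |A i j| ≤ 2)
    (w : Fin 3 → ℝ) : ‖A.mulVec w‖ ≤ 6 * ‖w‖ := by
  refine (pi_norm_le_iff_of_nonneg (by positivity)).2 fun i => ?_
  rw [Matrix.mulVec, dotProduct]
  refine (norm_sum_le_of_le (f := fun j => A i j * w j) _ (n := fun _ => 2 * ‖w‖)
    fun j _ => ?_).trans (by simp; linarith)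
  rw [norm_mul]
  exact mul_le_mul (hA i j) (norm_le_pi_norm w j) (norm_nonneg _) zero_le_two

lemma norm_Rrot_mulVec_le (θ : ℝ) (w : Fin 3 → ℝ) : ‖(Rrot θ).mulVec w‖ ≤ 6 * ‖w‖ := by
  refine norm_mulVec_le_of_abs_le (fun i j => ?_) w
  have h1 := Real.abs_sin_le_one θ
  have h2 := Real.abs_cos_le_one θ
  fin_cases i <;> fin_cases j <;> simp [Rrot] <;> linarith

lemma norm_scrR_mulVec_le (θ : ℝ) (w : Fin 3 → ℝ) : ‖(scrR θ).mulVec w‖ ≤ 6 * ‖w‖ := by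
  refine norm_mulVec_le_of_abs_le (fun i j => ?_) w
  have h1 := Real.abs_sin_le_one θ
  have h2 := Real.neg_one_le_cos θ
  have h3 := Real.cos_le_one θ
  have h4 : |Real.cos θ - 1| ≤ 2 := abs_le.2 ⟨by linarith, by linarith⟩
  have h5 : |1 - Real.cos θ| ≤ 2 := abs_le.2 ⟨by linarith, by linarith⟩
  fin_cases i <;> fin_cases j <;> simp [scrR] <;> linarith

@[fun_prop]
lemma continuous_Rrot : Continuous Rrot :=
  continuous_matrix fun i j => by fin_cases i <;> fin_cases j <;> simp [Rrot] <;> fun_prop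

@[fun_prop]
lemma continuous_scrR : Continuous scrR :=
  continuous_matrix fun i j => by fin_cases i <;> fin_cases j <;> simp [scrR] <;> fun_prop

lemma scrR_zero : scrR 0 = 0 := by
  ext i j
  fin_cases i <;> fin_cases j <;> simp [scrR]

lemma Rrot_zero : Rrot 0 = 1 := by
  ext i j
  fin_cases i <;> fin_cases j <;> simp [Rrot]

lemma Rrot_mulVec (θ : ℝ) (w : Fin 3 → ℝ) : (Rrot θ).mulVec w =
    ![w 0, Real.cos θ * w 1 + Real.sin θ * w 2, -Real.sin θ * w 1 + Real.cos θ * w 2] := by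
  ext i
  fin_cases i <;> simp [Rrot, Matrix.mulVec, dotProduct, Fin.sum_univ_three]

lemma scrR_mulVec (θ : ℝ) (w : Fin 3 → ℝ) : (scrR θ).mulVec w =
    ![0, Real.sin θ * w 1 + (1 - Real.cos θ) * w 2,
      (Real.cos θ - 1) * w 1 + Real.sin θ * w 2] := by
  ext i
  fin_cases i <;> simp [scrR, Matrix.mulVec, dotProduct, Fin.sum_univ_three]

lemma Rrot_mulVec_Rrot_neg_mulVec (θ : ℝ) (w : Fin 3 → ℝ) :
    (Rrot θ).mulVec ((Rrot (-θ)).mulVec w) = w := by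
  have h := Real.sin_sq_add_cos_sq θ
  ext i
  fin_cases i <;> simp [Rrot_mulVec]
  · linear_combination w 1 * h
  · linear_combination w 2 * h

lemma euclN_le (w : Fin 3 → ℝ) : euclN w ≤ 2 * ‖w‖ := by
  have h : ∀ i, w i ^ 2 ≤ ‖w‖ ^ 2 := fun i =>
    sq_le_sq' (neg_le_of_abs_le (norm_le_pi_norm w i)) (le_of_abs_le (norm_le_pi_norm w i))
  refine Real.sqrt_le_iff.2 ⟨by positivity, ?_⟩
  nlinarith [h 0, h 1, h 2, sq_nonneg ‖w‖]

lemma norm_vpar_le (w : Fin 3 → ℝ) : ‖vpar w‖ ≤ ‖w‖ := by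
  refine (pi_norm_le_iff_of_nonneg (norm_nonneg _)).2 fun i => ?_
  fin_cases i <;> simp [vpar]
  exact norm_le_pi_norm w 0

lemma vpar_sub (w w' : Fin 3 → ℝ) : vpar w - vpar w' = vpar (w - w') := by
  ext i
  fin_cases i <;> simp [vpar]

@[fun_prop]
lemma continuous_vpar : Continuous vpar :=
  continuous_pi fun i => by fin_cases i <;> simp [vpar] <;> fun_prop

/-- A `C¹` map with bounded derivative is Lipschitz in its second variable. -/
lemma exists_pos_norm_sub_le {E : ℝ → (Fin 3 → ℝ) → (Fin 3 → ℝ)}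
    (hEreg : ContDiff ℝ 1 (fun p : ℝ × (Fin 3 → ℝ) => E p.1 p.2))
    (hEbdd : ∃ C : ℝ, ∀ p : ℝ × (Fin 3 → ℝ),
      ‖iteratedFDeriv ℝ 1 (fun q : ℝ × (Fin 3 → ℝ) => E q.1 q.2) p‖ ≤ C) :
    ∃ L > 0, ∀ t y y', ‖E t y - E t y'‖ ≤ L * ‖y - y'‖ := by
  obtain ⟨C, hC⟩ := hEbdd
  refine ⟨|C| + 1, by positivity, fun t y y' => ?_⟩
  have h := convex_univ.norm_image_sub_le_of_norm_fderiv_le (𝕜 := ℝ) (C := |C| + 1)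
    (f := fun p : ℝ × (Fin 3 → ℝ) => E p.1 p.2) (x := (t, y')) (y := (t, y))
    (fun p _ => (hEreg.differentiable one_ne_zero) p) (fun p _ => ?_) (mem_univ _) (mem_univ _)
  · simpa using h
  · rw [← norm_iteratedFDeriv_one]
    exact (hC p).trans (by linarith [le_abs_self C])

/-- The vector field of the Finite Larmor Radius system in the filtered variables
`(X - 𝓡(θ)U, U)` with `U = R(-θ)V`, where `θ` is the fast phase. -/
noncomputable def filteredField (E : ℝ → (Fin 3 → ℝ) → (Fin 3 → ℝ)) (t θ : ℝ)
    (z : (Fin 3 → ℝ) × (Fin 3 → ℝ)) : (Fin 3 → ℝ) × (Fin 3 → ℝ) :=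
  (vpar z.2 + (scrR (-θ)).mulVec (E t (z.1 + (scrR θ).mulVec z.2)),
    (Rrot (-θ)).mulVec (E t (z.1 + (scrR θ).mulVec z.2)))

section FilteredField

variable {E : ℝ → (Fin 3 → ℝ) → (Fin 3 → ℝ)}

lemma continuous_filteredField (hE : Continuous fun p : ℝ × (Fin 3 → ℝ) => E p.1 p.2) :
    Continuous fun q : ℝ × ℝ × (Fin 3 → ℝ) × (Fin 3 → ℝ) =>
      filteredField E q.1 q.2.1 q.2.2 := by
  have h : Continuous fun q : ℝ × ℝ × (Fin 3 → ℝ) × (Fin 3 → ℝ) =>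
      E q.1 (q.2.2.1 + (scrR q.2.1).mulVec q.2.2.2) := by
    refine hE.comp (f := fun q : ℝ × ℝ × (Fin 3 → ℝ) × (Fin 3 → ℝ) =>
      (q.1, q.2.2.1 + (scrR q.2.1).mulVec q.2.2.2)) ?_
    refine continuous_fst.prodMk (Continuous.add (by fun_prop) ?_)
    exact Continuous.matrix_mulVec (by fun_prop) (by fun_prop)
  refine Continuous.prodMk (Continuous.add (by fun_prop) ?_) ?_ <;>
  exact Continuous.matrix_mulVec (by fun_prop) h

lemma periodic_filteredField (t : ℝ) (z : (Fin 3 → ℝ) × (Fin 3 → ℝ)) :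
    Function.Periodic (fun θ => filteredField E t θ z) (2 * π) := fun θ => by
  have h1 : ∀ θ, scrR (θ + 2 * π) = scrR θ := fun θ => by simp [scrR]
  have hsin : Real.sin (-(θ + 2 * π)) = Real.sin (-θ) := by
    rw [neg_add, ← sub_eq_add_neg, Real.sin_sub_two_pi]
  have hcos : Real.cos (-(θ + 2 * π)) = Real.cos (-θ) := by
    rw [neg_add, ← sub_eq_add_neg, Real.cos_sub_two_pi]
  have h2 : scrR (-(θ + 2 * π)) = scrR (-θ) := by simp only [scrR, hsin, hcos]
  have h3 : Rrot (-(θ + 2 * π)) = Rrot (-θ) := by simp only [Rrot, hsin, hcos]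
  simp only [filteredField, h1, h2, h3]

lemma norm_filteredField_sub_le {L : ℝ} (hL : 0 < L)
    (hE : ∀ t y y', ‖E t y - E t y'‖ ≤ L * ‖y - y'‖) (t θ : ℝ)
    (z z' : (Fin 3 → ℝ) × (Fin 3 → ℝ)) :
    ‖filteredField E t θ z - filteredField E t θ z'‖ ≤ (1 + 42 * L) * ‖z - z'‖ := by
  have hz1 : ‖z.1 - z'.1‖ ≤ ‖z - z'‖ := norm_fst_le (z - z')
  have hz2 : ‖z.2 - z'.2‖ ≤ ‖z - z'‖ := norm_snd_le (z - z')
  have hEz : ‖E t (z.1 + (scrR θ).mulVec z.2) - E t (z'.1 + (scrR θ).mulVec z'.2)‖ ≤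
      7 * L * ‖z - z'‖ := by
    refine (hE _ _ _).trans ?_
    rw [add_sub_add_comm, ← Matrix.mulVec_sub]
    have h := norm_scrR_mulVec_le θ (z.2 - z'.2)
    have h' := norm_add_le (z.1 - z'.1) ((scrR θ).mulVec (z.2 - z'.2))
    nlinarith
  have hnn := norm_nonneg (z - z')
  have hLn := mul_nonneg hL.le hnn
  rw [filteredField, filteredField, Prod.mk_sub_mk]
  refine norm_prod_le_iff.2 ⟨?_, ?_⟩
  · rw [add_sub_add_comm, ← Matrix.mulVec_sub, vpar_sub]
    have h := norm_add_le (vpar (z.2 - z'.2)) ((scrR (-θ)).mulVec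
      (E t (z.1 + (scrR θ).mulVec z.2) - E t (z'.1 + (scrR θ).mulVec z'.2)))
    have h1 := norm_vpar_le (z.2 - z'.2)
    have h2 := norm_scrR_mulVec_le (-θ)
      (E t (z.1 + (scrR θ).mulVec z.2) - E t (z'.1 + (scrR θ).mulVec z'.2))
    dsimp only
    linarith
  · rw [← Matrix.mulVec_sub]
    have h2 := norm_Rrot_mulVec_le (-θ)
      (E t (z.1 + (scrR θ).mulVec z.2) - E t (z'.1 + (scrR θ).mulVec z'.2))
    dsimp only
    linarith

lemma average_filteredField (hE : Continuous fun p : ℝ × (Fin 3 → ℝ) => E p.1 p.2) (t : ℝ)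
    (z : (Fin 3 → ℝ) × (Fin 3 → ℝ)) :
    (2 * π)⁻¹ • ∫ θ in (0 : ℝ)..(2 * π), filteredField E t θ z =
      (vpar z.2 + (2 * π)⁻¹ • ∫ θ in (0 : ℝ)..(2 * π),
          (scrR (-θ)).mulVec (E t (z.1 + (scrR θ).mulVec z.2)),
        (2 * π)⁻¹ • ∫ θ in (0 : ℝ)..(2 * π),
          (Rrot (-θ)).mulVec (E t (z.1 + (scrR θ).mulVec z.2))) := by
  have hc : Continuous fun θ => filteredField E t θ z :=
    (continuous_filteredField hE).comp (f := fun θ => (t, θ, z)) (by fun_prop)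
  have hi := hc.intervalIntegrable (μ := volume) 0 (2 * π)
  have hs : Continuous fun θ => (scrR (-θ)).mulVec (E t (z.1 + (scrR θ).mulVec z.2)) := by
    have h := hc.fst.sub (continuous_const (y := vpar z.2))
    exact h.congr fun θ => add_sub_cancel_left _ _
  have h1 := ContinuousLinearMap.intervalIntegral_comp_comm
    (ContinuousLinearMap.fst ℝ (Fin 3 → ℝ) (Fin 3 → ℝ)) hi
  have h2 := ContinuousLinearMap.intervalIntegral_comp_comm
    (ContinuousLinearMap.snd ℝ (Fin 3 → ℝ) (Fin 3 → ℝ)) hi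
  simp only [ContinuousLinearMap.coe_fst', ContinuousLinearMap.coe_snd', filteredField] at h1 h2
  rw [intervalIntegral.integral_add (continuous_const.intervalIntegrable _ _)
    (hs.intervalIntegrable _ _), intervalIntegral.integral_const, sub_zero] at h1
  have hπ : (2 * π : ℝ) ≠ 0 := by positivity
  refine Prod.ext ?_ ?_
  · rw [Prod.smul_fst]
    simp only [filteredField]
    rw [← h1, smul_add, inv_smul_smul₀ hπ]
  · rw [Prod.smul_snd]
    simp only [filteredField]
    rw [← h2]

/-- Passing to the filtered variables removes the stiff terms of the system. -/
lemma hasDerivAt_filtered {X V : ℝ → (Fin 3 → ℝ)} {ε s t : ℝ}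
    (hX : HasDerivAt X (vpar (V t) + ε⁻¹ • (V t - vpar (V t))) t)
    (hV : HasDerivAt V (E t (X t) + ε⁻¹ • cross3 (V t) ee1) t) :
    HasDerivAt (fun r => (X r - (scrR ((r - s) / ε)).mulVec
        ((Rrot (-((r - s) / ε))).mulVec (V r)), (Rrot (-((r - s) / ε))).mulVec (V r)))
      (filteredField E t ((t - s) / ε) (X t - (scrR ((t - s) / ε)).mulVec
        ((Rrot (-((t - s) / ε))).mulVec (V t)), (Rrot (-((t - s) / ε))).mulVec (V t))) t := by
  have hτ : HasDerivAt (fun r => (r - s) / ε) ε⁻¹ t := by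
    simpa using ((hasDerivAt_id t).sub_const s).div_const ε
  have hcos := hτ.cos
  have hsin := hτ.sin
  have hX' := hasDerivAt_pi.1 hX
  have hV' := hasDerivAt_pi.1 hV
  have hsc := Real.sin_sq_add_cos_sq ((t - s) / ε)
  have hU : HasDerivAt (fun r => (Rrot (-((r - s) / ε))).mulVec (V r))
      ((Rrot (-((t - s) / ε))).mulVec (E t (X t))) t := by
    simp only [Rrot_mulVec, Real.cos_neg, Real.sin_neg, neg_neg]
    refine hasDerivAt_pi.2 fun i => ?_
    fin_cases i
    · refine (hV' 0).congr_deriv ?_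
      simp [cross3, ee1]
    · refine ((hcos.mul (hV' 1)).add (hsin.neg.mul (hV' 2))).congr_deriv ?_
      simp [cross3, ee1]
      ring
    · refine ((hsin.mul (hV' 1)).add (hcos.mul (hV' 2))).congr_deriv ?_
      simp [cross3, ee1]
      ring
  refine HasDerivAt.prodMk ?_ (by simpa only [filteredField, sub_add_cancel] using hU)
  simp only [sub_add_cancel]
  have hU' := hasDerivAt_pi.1 hU
  have hcos' := hcos.const_sub 1
  have hcos'' := hcos.sub_const 1
  simp only [scrR_mulVec _ (Matrix.mulVec _ (V _))]
  refine hasDerivAt_pi.2 fun i => ?_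
  fin_cases i
  · refine ((hX' 0).sub_const 0).congr_deriv ?_
    simp [vpar, scrR_mulVec, Rrot_mulVec, Matrix.vecHead, Matrix.vecTail]
  · refine ((hX' 1).sub ((hsin.mul (hU' 1)).add (hcos'.mul (hU' 2)))).congr_deriv ?_
    simp [vpar, scrR_mulVec, Rrot_mulVec, Matrix.vecHead, Matrix.vecTail]
    linear_combination (E t (X t) 2 - ε⁻¹ * V t 1) * hsc
  · refine ((hX' 2).sub ((hcos''.mul (hU' 1)).add (hsin.mul (hU' 2)))).congr_deriv ?_
    simp [vpar, scrR_mulVec, Rrot_mulVec, Matrix.vecHead, Matrix.vecTail]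
    linear_combination (-E t (X t) 1 - ε⁻¹ * V t 2) * hsc

end FilteredField

/-- A family of nonnegative functions converging uniformly to zero has suprema tending to zero. -/
lemma tendsto_iSup_zero_of_uniform {ι : Type*} {f : ℝ → ι → ℝ} (hf : ∀ ε i, 0 ≤ f ε i)
    (h : ∀ η > 0, ∃ ε₀ > 0, ∀ ε, 0 < ε → ε < ε₀ → ∀ i, f ε i ≤ η) :
    Tendsto (fun ε => ⨆ i, f ε i) (nhdsWithin 0 (Ioi 0)) (nhds 0) := by
  refine Metric.tendsto_nhds.2 fun η hη => ?_
  obtain ⟨ε₀, hε₀, hle⟩ := h (η / 2) (by positivity)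
  filter_upwards [Ioo_mem_nhdsGT hε₀] with ε hε
  rw [Real.dist_0_eq_abs, abs_of_nonneg (Real.iSup_nonneg (hf ε))]
  exact (Real.iSup_le (hle ε hε.1 hε.2) (by positivity)).trans_lt (by linarith)

/-- Order-0 two-scale asymptotics for the Finite Larmor Radius regime with a constant
strong magnetic field. -/
theorem stmt_11
    (E : ℝ → (Fin 3 → ℝ) → (Fin 3 → ℝ))
    (hEreg : ContDiff ℝ 1 (fun p : ℝ × (Fin 3 → ℝ) => E p.1 p.2))
    (hEbdd : ∀ k : ℕ, k ≤ 1 → ∃ C : ℝ, ∀ p : ℝ × (Fin 3 → ℝ),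
      ‖iteratedFDeriv ℝ k (fun q : ℝ × (Fin 3 → ℝ) => E q.1 q.2) p‖ ≤ C)
    (x v : Fin 3 → ℝ) (s : ℝ)
    (X V : ℝ → ℝ → (Fin 3 → ℝ))
    (hXinit : ∀ ε : ℝ, 0 < ε → X ε s = x)
    (hVinit : ∀ ε : ℝ, 0 < ε → V ε s = v)
    (hXode : ∀ ε : ℝ, 0 < ε → ∀ t : ℝ, HasDerivAt (X ε)
      (vpar (V ε t) + ε⁻¹ • (V ε t - vpar (V ε t))) t)
    (hVode : ∀ ε : ℝ, 0 < ε → ∀ t : ℝ, HasDerivAt (V ε)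
      (E t (X ε t) + ε⁻¹ • cross3 (V ε t) ee1) t)
    (Y0 U0 : ℝ → (Fin 3 → ℝ))
    (hY0init : Y0 s = x) (hU0init : U0 s = v)
    (hY0ode : ∀ t : ℝ, HasDerivAt Y0
      (vpar (U0 t) + (2 * π)⁻¹ • ∫ θ in (0:ℝ)..(2 * π),
        (scrR (-θ)).mulVec (E t (Y0 t + (scrR θ).mulVec (U0 t)))) t)
    (hU0ode : ∀ t : ℝ, HasDerivAt U0
      ((2 * π)⁻¹ • ∫ θ in (0:ℝ)..(2 * π),
        (Rrot (-θ)).mulVec (E t (Y0 t + (scrR θ).mulVec (U0 t)))) t) :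
    ∀ T : ℝ, 0 < T →
      Tendsto (fun ε : ℝ => ⨆ t : Icc s (s + T),
          euclN (X ε t.1 - (Y0 t.1 + (scrR ((t.1 - s) / ε)).mulVec (U0 t.1))))
        (nhdsWithin 0 (Ioi 0)) (nhds 0) ∧
      Tendsto (fun ε : ℝ => ⨆ t : Icc s (s + T),
          euclN (V ε t.1 - (Rrot ((t.1 - s) / ε)).mulVec (U0 t.1)))
        (nhdsWithin 0 (Ioi 0)) (nhds 0) := by
  intro T hT
  obtain ⟨L, hL, hLip⟩ := exists_pos_norm_sub_le hEreg (hEbdd 1 le_rfl)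
  have hEc := hEreg.continuous
  have hclose : ∀ η > 0, ∃ ε₀ > 0, ∀ ε, 0 < ε → ε < ε₀ → ∀ t ∈ Icc s (s + T),
      ‖((X ε t - (scrR ((t - s) / ε)).mulVec ((Rrot (-((t - s) / ε))).mulVec (V ε t)),
        (Rrot (-((t - s) / ε))).mulVec (V ε t)) : (Fin 3 → ℝ) × (Fin 3 → ℝ)) -
          (Y0 t, U0 t)‖ ≤ η := fun η hη =>
    exists_norm_sub_averaged_solution_le (Z₀ := fun t => (Y0 t, U0 t))
      (Z := fun ε t => (X ε t - (scrR ((t - s) / ε)).mulVec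
        ((Rrot (-((t - s) / ε))).mulVec (V ε t)), (Rrot (-((t - s) / ε))).mulVec (V ε t)))
      (continuous_filteredField hEc) periodic_filteredField two_pi_pos (by positivity)
      (norm_filteredField_sub_le hL hLip)
      (fun ε hε => by simp [hXinit ε hε, hVinit ε hε, hY0init, hU0init, scrR_zero, Rrot_zero])
      (fun ε hε t => hasDerivAt_filtered (hXode ε hε t) (hVode ε hε t))
      (fun t => by
        rw [average_filteredField hEc]
        exact (hY0ode t).prodMk (hU0ode t))
      hT hη
  constructor
  · refine tendsto_iSup_zero_of_uniform (fun _ _ => Real.sqrt_nonneg _) fun η hη => ?_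
    obtain ⟨ε₀, hε₀, h⟩ := hclose (η / 14) (by positivity)
    refine ⟨ε₀, hε₀, fun ε hε hlt t => (euclN_le _).trans ?_⟩
    have ht := h ε hε hlt t t.2
    rw [Prod.mk_sub_mk] at ht
    obtain ⟨h1, h2⟩ := norm_prod_le_iff.1 ht
    dsimp only at h1 h2
    have h3 := norm_scrR_mulVec_le ((t.1 - s) / ε)
      ((Rrot (-((t.1 - s) / ε))).mulVec (V ε t) - U0 t)
    have h4 := norm_add_le (X ε t - (scrR ((t.1 - s) / ε)).mulVec
        ((Rrot (-((t.1 - s) / ε))).mulVec (V ε t)) - Y0 t) ((scrR ((t.1 - s) / ε)).mulVec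
      ((Rrot (-((t.1 - s) / ε))).mulVec (V ε t) - U0 t))
    have h5 : X ε t - (Y0 t + (scrR ((t.1 - s) / ε)).mulVec (U0 t)) =
        X ε t - (scrR ((t.1 - s) / ε)).mulVec
        ((Rrot (-((t.1 - s) / ε))).mulVec (V ε t)) - Y0 t + (scrR ((t.1 - s) / ε)).mulVec
      ((Rrot (-((t.1 - s) / ε))).mulVec (V ε t) - U0 t) := by
      rw [Matrix.mulVec_sub]
      abel
    rw [h5]
    linarith
  · refine tendsto_iSup_zero_of_uniform (fun _ _ => Real.sqrt_nonneg _) fun η hη => ?_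
    obtain ⟨ε₀, hε₀, h⟩ := hclose (η / 12) (by positivity)
    refine ⟨ε₀, hε₀, fun ε hε hlt t => (euclN_le _).trans ?_⟩
    have ht := h ε hε hlt t t.2
    rw [Prod.mk_sub_mk] at ht
    have h2 := (norm_prod_le_iff.1 ht).2
    dsimp only at h2
    have h3 := norm_Rrot_mulVec_le ((t.1 - s) / ε)
      ((Rrot (-((t.1 - s) / ε))).mulVec (V ε t) - U0 t)
    rw [Matrix.mulVec_sub, Rrot_mulVec_Rrot_neg_mulVec] at h3
    linarith
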